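/- (Lemma 4.3.) Assume char F = p ≠ 2 and let f ∈ N_σ be nonzero. Then there exists q ≥ 0 such that ∂_q∂_{q−1}⋯∂_1(f) is a nonzero p-multilinear element of N̂_σ (for q = 0 this composition is f itself). -/

import Mathlib

/-! Statement 13: (Lemma 4.3.) A nonzero `f ∈ N_σ` has a nonzero `p`-multilinear
iterated derivative `∂_q ⋯ ∂_1(f)`. -/

open scoped BigOperators
open Matrix

/-- Base names of letters: `Sum.inl k` is `x_k`, `Sum.inr (k, s)` is `y_{ks}`. -/
abbrev HBase (d : ℕ) := Fin d ⊕ (Fin d × ℕ+)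

/-- Letters of `M̂`: a base name together with a flag marking the transpose. -/
abbrev HLetter (d : ℕ) := HBase d × Bool

/-- The involution on letters: `z ↦ z^T`, `z^T ↦ z`. -/
def hTau {d : ℕ} (l : HLetter d) : HLetter d := (l.1, !l.2)

/-- The level of a letter: `0` for `x_k`, `x_k^T`, and `s` for `y_{ks}`, `y_{ks}^T`.
A word lies in `M̂(q)` iff all its letters have level `≤ q`. -/
def letterLevel {d : ℕ} (l : HLetter d) : ℕ :=
  match l.1 with
  | Sum.inl _ => 0
  | Sum.inr (_, s) => s

/-- The transpose of a word: reverse it and apply the involution to each letter. -/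
def wordT {A : Type*} (τ : A → A) (w : List A) : List A := (w.reverse).map τ

/-- The `m`-th power `e^m` of a word `e` (concatenation of `m` copies). -/
def wpow {A : Type*} (e : List A) (m : ℕ) : List A := (List.replicate m e).flatten

/-- A word is primitive if it is nonempty and is not a power `e^m` with `m ≥ 2`. -/
def WPrimitive {A : Type*} (w : List A) : Prop :=
  w ≠ [] ∧ ∀ (e : List A) (m : ℕ), 2 ≤ m → w ≠ wpow e m

/-- `a ∼ b`: `b` is a cyclic permutation of `a` or of `a^T`. -/
def simRel {A : Type*} (τ : A → A) (a b : List A) : Prop :=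
  List.IsRotated a b ∨ List.IsRotated a (wordT τ b)

/-- Primitive words in `M̂`. -/
def PrimWordH (d : ℕ) := {w : List (HLetter d) // WPrimitive w}

/-- `∼`-equivalence classes of primitive words of `M̂`. -/
def WClsH (d : ℕ) := Quot (fun a b : PrimWordH d => simRel hTau a.1 b.1)

/-- The polynomial algebra `N̂_σ` on indeterminates `σ_t(ā)`, `t ≥ 1`,
`ā` a `∼`-class of primitive words of `M̂`. -/
abbrev NsigmaH (F : Type*) [CommSemiring F] (d : ℕ) := MvPolynomial (ℕ+ × WClsH d) F

/-- `tr(w) = σ_1(w̄)` for a primitive word `w` (and junk value `0` otherwise; all words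
to which `tr` is applied below are primitive). -/
noncomputable def trW (F : Type*) [CommSemiring F] {d : ℕ} (w : List (HLetter d)) :
    NsigmaH F d := by
  classical exact
    if h : WPrimitive w then MvPolynomial.X (1, Quot.mk _ (⟨w, h⟩ : PrimWordH d)) else 0

/-- `σ_t(ā)` as an element of `N̂_σ`, with the convention `σ_0 = 1`. -/
noncomputable def sigVar (F : Type*) [CommSemiring F] {d : ℕ} (t : ℕ) (c : WClsH d) :
    NsigmaH F d :=
  if h : 0 < t then MvPolynomial.X ((⟨t, h⟩ : ℕ+), c) else 1

/-- The list of words occurring in `∂_q(a) = Σ_j a_1 ⋯ ∂_q(a_j) ⋯ a_r` (a summand for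
each position `j` holding a letter `x_k` or `x_k^T`, which is replaced by `y_{kq}` or
`y_{kq}^T`; positions holding `y`-letters contribute `0` and are omitted). -/
def derivWords {d : ℕ} (q : ℕ+) (a : List (HLetter d)) : List (List (HLetter d)) :=
  (List.range a.length).filterMap fun j =>
    match a[j]? with
    | some (Sum.inl k, b) => some (a.set j (Sum.inr (k, q), b))
    | _ => none

/-- The value of the symbolic derivation `∂_q` on the indeterminate `σ_t(ā)`:
`∂_q(σ_t(a)) = Σ_{i=0}^{t-1} (-1)^i tr(a^i ∂_q(a)) σ_{t-i-1}(a)`. -/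
noncomputable def dVal (F : Type*) [CommRing F] {d : ℕ} (q : ℕ+)
    (v : ℕ+ × WClsH d) : NsigmaH F d :=
  ∑ i ∈ Finset.range (v.1 : ℕ),
    (-1 : NsigmaH F d) ^ i *
      ((derivWords q (Quot.out v.2).1).map
          (fun w => trW F (wpow (Quot.out v.2).1 i ++ w))).sum *
        sigVar F ((v.1 : ℕ) - i - 1) v.2

/-- The symbolic derivation `∂_q : N̂_σ → N̂_σ` (defined on indeterminates by `dVal` and
extended by linearity and the Leibniz rule). -/
noncomputable def DS (F : Type*) [CommRing F] (d : ℕ) (q : ℕ+) :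
    Derivation F (NsigmaH F d) (NsigmaH F d) :=
  MvPolynomial.mkDerivation F (dVal F q)

/-- Variables of the polynomial ring `R̂_n`: `Sum.inl (i,j,k)` is `x_{ij}(k)` and
`Sum.inr (i,j,k,s)` is `y_{ij}(k,s)`. -/
abbrev VarHat (n d : ℕ) := (Fin n × Fin n × Fin d) ⊕ (Fin n × Fin n × Fin d × ℕ+)

/-- The polynomial ring `R̂_n = F[x_{ij}(k), y_{ij}(k,s)]`. -/
abbrev Rhat (F : Type*) [CommSemiring F] (n d : ℕ) := MvPolynomial (VarHat n d) F

/-- The derivation `∂_q(f) = Σ_k Σ_{i,j} (∂f/∂x_{ij}(k))·y_{ij}(k,q)` on `R̂_n`. -/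
noncomputable def Dq (F : Type*) [Field F] (n d : ℕ) (q : ℕ+) (f : Rhat F n d) :
    Rhat F n d :=
  ∑ k : Fin d, ∑ i : Fin n, ∑ j : Fin n,
    MvPolynomial.pderiv (Sum.inl (i, j, k)) f * MvPolynomial.X (Sum.inr (i, j, k, q))

/-- The matrix of a letter: generic matrices `X_k`, `Y_{ks}` and their transposes. -/
noncomputable def hLetterMat (F : Type*) [Field F] (n d : ℕ) (l : HLetter d) :
    Matrix (Fin n) (Fin n) (Rhat F n d) :=
  match l with
  | (Sum.inl k, false) => Matrix.of fun i j => MvPolynomial.X (Sum.inl (i, j, k))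
  | (Sum.inl k, true) => (Matrix.of fun i j =>
      (MvPolynomial.X (Sum.inl (i, j, k)) : Rhat F n d))ᵀ
  | (Sum.inr (k, s), false) => Matrix.of fun i j => MvPolynomial.X (Sum.inr (i, j, k, s))
  | (Sum.inr (k, s), true) => (Matrix.of fun i j =>
      (MvPolynomial.X (Sum.inr (i, j, k, s)) : Rhat F n d))ᵀ

/-- The matrix `X_a` of a word `a = a_1 ⋯ a_r` of `M̂`. -/
noncomputable def hWordMat (F : Type*) [Field F] (n d : ℕ) (w : List (HLetter d)) :
    Matrix (Fin n) (Fin n) (Rhat F n d) :=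
  (w.map (hLetterMat F n d)).prod

/-- `σ_t(A)`: the coefficient of `λ^{n-t}` in `det(A + λE)`. -/
noncomputable def msigma {R : Type*} [CommRing R] {ι : Type*} [Fintype ι] [DecidableEq ι]
    (t : ℕ) (A : Matrix ι ι R) : R :=
  ((A.map Polynomial.C + (Polynomial.X : Polynomial R) • 1).det).coeff (Fintype.card ι - t)

/-- The evaluation homomorphism `Ψ̂_n : N̂_σ → R̂_n`, sending `σ_t(ā)` to `σ_t(X_a)` if
`t ≤ n` and to `0` otherwise (it does not depend on the representative of `ā`). -/
noncomputable def PsiHat (F : Type*) [Field F] (n d : ℕ) :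
    NsigmaH F d →ₐ[F] Rhat F n d :=
  MvPolynomial.aeval fun v : ℕ+ × WClsH d =>
    if (v.1 : ℕ) ≤ n then msigma v.1 (hWordMat F n d (Quot.out v.2).1) else 0

/-- `deg_z(w)`: the number of occurrences of the letters `z` and `z^T` in the word `w`
(`z` being one of `x_k`, `y_{ks}`). -/
def hdeg {d : ℕ} (z : HBase d) (w : List (HLetter d)) : ℕ :=
  (w.filter (fun l => decide (l.1 = z))).length

/-- `deg_z(f_u⁺)` for the monomial with exponent function `u`: the degree in `z` of the
part `f_u⁺` of the monomial collecting all `p`-th powers (`f_u⁺ = 1` when `p = 0`). -/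
noncomputable def monDegPlus (p : ℕ) {d : ℕ} (z : HBase d)
    (u : (ℕ+ × WClsH d) →₀ ℕ) : ℕ :=
  ∑ v ∈ u.support, (u v - u v % p) * (v.1 : ℕ) * hdeg z (Quot.out v.2).1

/-- `deg_z(f_u⁻)` for the monomial with exponent function `u`: the degree in `z` of the
part `f_u⁻` where every indeterminate occurs with exponent `< p` (`f_u⁻ = f_u` when
`p = 0`). -/
noncomputable def monDegMinus (p : ℕ) {d : ℕ} (z : HBase d)
    (u : (ℕ+ × WClsH d) →₀ ℕ) : ℕ :=
  ∑ v ∈ u.support, (u v % p) * (v.1 : ℕ) * hdeg z (Quot.out v.2).1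

/-- `f` is `p`-multilinear (`p = char F`): there is a set `I` of letters such that every
monomial `f_w` of `f` satisfies `deg_z(f_w⁺) = 0` and `deg_z(f_w⁻) ≤ 1` for every
letter `z ∉ I`, and `deg_z(f_w⁻) = 0` for every `z ∈ I`. -/
def PMulti (F : Type*) [Field F] {d : ℕ} (f : NsigmaH F d) : Prop :=
  ∃ I : Set (HBase d), ∀ u ∈ f.support,
    (∀ z ∉ I, monDegPlus (ringChar F) z u = 0 ∧ monDegMinus (ringChar F) z u ≤ 1) ∧
    (∀ z ∈ I, monDegMinus (ringChar F) z u = 0)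

/-- The iterated symbolic derivative `∂_q ∂_{q-1} ⋯ ∂_1(f)` (equal to `f` for `q = 0`). -/
noncomputable def DSIter (F : Type*) [CommRing F] (d : ℕ) : ℕ → NsigmaH F d → NsigmaH F d
  | 0, f => f
  | (q + 1), f => DS F d q.succPNat (DSIter F d q f)


section Words
variable {A : Type*}

theorem wpow_succ (e : List A) (m : ℕ) : wpow e (m+1) = e ++ wpow e m := by
  simp [wpow, List.replicate_succ]

theorem wpow_zero (e : List A) : wpow e 0 = [] := by simp [wpow]

theorem wpow_one (e : List A) : wpow e 1 = e := by simp [wpow]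

theorem wpow_add (e : List A) (m n : ℕ) : wpow e (m+n) = wpow e m ++ wpow e n := by
  rw [wpow, List.replicate_add, List.flatten_append]; rfl

theorem wpow_succ' (e : List A) (m : ℕ) : wpow e (m+1) = wpow e m ++ e := by
  rw [wpow_add, wpow_one]

theorem wpow_length (e : List A) (m : ℕ) : (wpow e m).length = m * e.length := by
  simp [wpow]

theorem wpow_map {B : Type*} (f : A → B) (e : List A) (m : ℕ) :
    (wpow e m).map f = wpow (e.map f) m := by
  simp [wpow, List.map_flatten]

theorem wpow_reverse (e : List A) (m : ℕ) : (wpow e m).reverse = wpow e.reverse m := by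
  induction m with
  | zero => simp [wpow_zero]
  | succ m ih => rw [wpow_succ, List.reverse_append, ih, wpow_succ']

theorem wpow_countP (P : A → Bool) (e : List A) (m : ℕ) :
    (wpow e m).countP P = m * e.countP P := by
  induction m with
  | zero => simp [wpow_zero]
  | succ m ih => rw [wpow_succ, List.countP_append, ih]; ring

/-- conjugation: `(uv)^m u = u (vu)^m` -/
theorem wpow_conj (u v : List A) (m : ℕ) : wpow (u ++ v) m ++ u = u ++ wpow (v ++ u) m := by
  induction m with
  | zero => simp [wpow_zero]
  | succ m ih => rw [wpow_succ, wpow_succ, List.append_assoc, ih]; simp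

theorem rot_iff {l l' : List A} : List.IsRotated l l' ↔ ∃ u v, l = u ++ v ∧ l' = v ++ u := by
  constructor
  · intro h
    obtain ⟨n, hn, rfl⟩ := List.isRotated_iff_mod.1 h
    exact ⟨l.take n, l.drop n, by simp, List.rotate_eq_drop_append_take hn⟩
  · rintro ⟨u, v, rfl, rfl⟩
    exact List.isRotated_append

theorem comm_pow : ∀ (n : ℕ) (u v : List A), u.length + v.length ≤ n → u ++ v = v ++ u →
    ∃ c i j, u = wpow c i ∧ v = wpow c j := by
  intro n
  induction n with
  | zero =>
    intro u v h _
    have hu : u = [] := List.length_eq_zero_iff.1 (by omega)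
    have hv : v = [] := List.length_eq_zero_iff.1 (by omega)
    exact ⟨[], 0, 0, by simp [hu, wpow_zero], by simp [hv, wpow_zero]⟩
  | succ n ih =>
    have key : ∀ u v : List A, u.length ≤ v.length → u.length + v.length ≤ n + 1 →
        u ++ v = v ++ u → ∃ c i j, u = wpow c i ∧ v = wpow c j := by
      intro u v hl hn h
      rcases eq_or_ne u [] with rfl | hu
      · exact ⟨v, 0, 1, by simp [wpow_zero], by simp [wpow_one]⟩
      · have hpre : u <+: v :=
          List.prefix_of_prefix_length_le (List.prefix_append u v) (h ▸ List.prefix_append v u) hl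
        obtain ⟨w, rfl⟩ := hpre
        have hup := List.length_pos_iff.2 hu
        simp only [List.length_append] at hn
        have h2 : u ++ w = w ++ u := by simpa using h
        obtain ⟨c, i, j, hi, hj⟩ := ih u w (by omega) h2
        exact ⟨c, i, i + j, hi, by rw [wpow_add, ← hi, ← hj]⟩
    intro u v hn h
    rcases le_total u.length v.length with hl | hl
    · exact key u v hl hn h
    · obtain ⟨c, i, j, hi, hj⟩ := key v u hl (by omega) h.symm
      exact ⟨c, j, i, hj, hi⟩

theorem prim_pow {a c : List A} {i : ℕ} (ha : WPrimitive a) (h : a = wpow c i) : i = 1 ∧ a = c := by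
  match i, h with
  | 0, h => exact absurd h (by rw [wpow_zero]; exact ha.1)
  | 1, h => exact ⟨rfl, by rw [h, wpow_one]⟩
  | i+2, h => exact absurd h (ha.2 c _ (by omega))

theorem prim_comm {a b : List A} (ha : WPrimitive a) (hb : WPrimitive b) (h : a ++ b = b ++ a) :
    a = b := by
  obtain ⟨c, i, j, hi, hj⟩ := comm_pow _ a b le_rfl h
  rw [(prim_pow ha hi).2, (prim_pow hb hj).2]

theorem wpow_eq_comm {a b : List A} {n m : ℕ} (h : wpow a (n+1) = wpow b (m+1)) :
    a ++ b = b ++ a := by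
  -- b^m a = a y
  have h1 : a <+: wpow b m ++ a := by
    have e1 : a <+: wpow b m ++ wpow a (n+1) := by
      rw [h, ← wpow_add, add_comm, wpow_add, ← h, wpow_succ]
      simp
    have e2 : wpow b m ++ a <+: wpow b m ++ wpow a (n+1) := by
      rw [wpow_succ, ← List.append_assoc]; simp
    exact List.prefix_of_prefix_length_le e1 e2 (by simp)
  obtain ⟨y, hy⟩ := h1
  have h2 : a ++ wpow b (m+1) = wpow b (m+1) ++ a := by
    rw [← h, ← wpow_succ, ← wpow_succ']
  rw [wpow_succ, ← List.append_assoc, List.append_assoc b, ← hy, ← List.append_assoc] at h2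
  exact (List.append_inj h2 (by simp [add_comm])).1

theorem prim_pow_eq {a b : List A} {n m : ℕ} (ha : WPrimitive a) (hb : WPrimitive b)
    (h : wpow a (n+1) = wpow b (m+1)) : a = b ∧ n = m := by
  have e := prim_comm ha hb (wpow_eq_comm h)
  subst e
  refine ⟨rfl, ?_⟩
  have := congrArg List.length h
  rw [wpow_length, wpow_length] at this
  have := Nat.eq_of_mul_eq_mul_right (List.length_pos_iff.2 ha.1) this
  omega

theorem prim_rot {a b : List A} (h : List.IsRotated a b) (ha : WPrimitive a) : WPrimitive b := by
  refine ⟨fun hb => ha.1 (by subst hb; simpa using h), ?_⟩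
  rintro e m hm rfl
  obtain ⟨m, rfl⟩ : ∃ k, m = k + 1 := ⟨m - 1, by omega⟩
  obtain ⟨k, hk⟩ := h.symm
  have : ∀ k, ∃ e', (wpow e (m+1)).rotate k = wpow e' (m+1) := by
    intro k
    induction k with
    | zero => exact ⟨e, by simp⟩
    | succ k ih =>
      obtain ⟨e', he⟩ := ih
      rw [← List.rotate_rotate, he]
      cases e' with
      | nil => exact ⟨[], by simp [wpow]⟩
      | cons x l =>
        refine ⟨l ++ [x], ?_⟩
        rw [wpow_succ, List.cons_append, List.rotate_cons_succ, List.rotate_zero, List.append_assoc]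
        have := wpow_conj [x] l m
        simp only [List.singleton_append] at this
        rw [this, wpow_succ]; simp
  obtain ⟨e', he⟩ := this k
  exact ha.2 e' _ hm (hk ▸ he)

theorem rot_pow {a b : List A} {n m : ℕ} (ha : WPrimitive a) (hb : WPrimitive b)
    (h : List.IsRotated (wpow a (n+1)) (wpow b (m+1))) : List.IsRotated a b ∧ n = m := by
  obtain ⟨k, hk⟩ := h
  have : ∀ k, ∃ e', List.IsRotated a e' ∧ (wpow a (n+1)).rotate k = wpow e' (n+1) := by
    intro k
    induction k with
    | zero => exact ⟨a, List.IsRotated.refl _, by simp⟩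
    | succ k ih =>
      obtain ⟨e', hr, he⟩ := ih
      rw [← List.rotate_rotate, he]
      cases e' with
      | nil => exact ⟨[], hr, by simp [wpow]⟩
      | cons x l =>
        refine ⟨l ++ [x], hr.trans (rot_iff.2 ⟨[x], l, rfl, rfl⟩), ?_⟩
        rw [wpow_succ, List.cons_append, List.rotate_cons_succ, List.rotate_zero, List.append_assoc]
        have := wpow_conj [x] l n
        simp only [List.singleton_append] at this
        rw [this, wpow_succ]; simp
  obtain ⟨e', hr, he⟩ := this k
  rw [hk] at he
  obtain ⟨h1, h2⟩ := prim_pow_eq hb (prim_rot hr ha) he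
  exact ⟨h1 ▸ hr, h2.symm⟩

/-- two factorizations of a primitive word giving the same rotation coincide -/
theorem prim_split {u v u' v' : List A} (ha : WPrimitive (u ++ v)) (h : u ++ v = u' ++ v')
    (hv : v ≠ []) (hv' : v' ≠ [])
    (hr : v ++ u = v' ++ u') : u = u' := by
  have key : ∀ u v u' v' : List A, WPrimitive (u ++ v) → u ++ v = u' ++ v' → v ≠ [] → v' ≠ [] →
     v ++ u = v' ++ u' → u.length ≤ u'.length → u = u' := by
    intro u v u' v' ha h hv hv' hr hl
    have hp : u <+: u' := List.prefix_of_prefix_length_le (List.prefix_append u v)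
      (h ▸ List.prefix_append u' v') hl
    obtain ⟨s, rfl⟩ := hp
    have hv2 : v = s ++ v' := by simpa using h
    subst hv2
    have h3 : s ++ (v' ++ u) = (v' ++ u) ++ s := by simpa using hr
    have hprim : WPrimitive (s ++ (v' ++ u)) := by
      rw [← List.append_assoc]
      exact prim_rot (rot_iff.2 ⟨u, s ++ v', rfl, rfl⟩) ha
    obtain ⟨c, i, j, hi, hj⟩ := comm_pow _ _ _ le_rfl h3
    have h1 := (prim_pow hprim (c := c) (i := i + j) (by rw [wpow_add, ← hi, ← hj])).1
    have hj0 : j ≠ 0 := by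
      rintro rfl
      rw [wpow_zero] at hj
      exact hv' (List.append_eq_nil_iff.1 hj).1
    have : i = 0 := by omega
    subst this
    rw [wpow_zero] at hi
    simp [hi]
  rcases le_total u.length u'.length with hl | hl
  · exact key u v u' v' ha h hv hv' hr hl
  · exact (key u' v' u v (h ▸ ha) h.symm hv' hv hr.symm hl).symm

theorem rot_unique {P : A → Prop} {y y' : A} {T T' : List A} (hy' : P y')
    (hT : ∀ x ∈ T, ¬ P x) (h : List.IsRotated (y :: T) (y' :: T')) : y = y' ∧ T = T' := by
  obtain ⟨u, v, h1, h2⟩ := rot_iff.1 h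
  cases u with
  | nil => simp at h1 h2; subst h1; simpa using h2.symm
  | cons z u =>
    cases v with
    | nil => 
      simp at h1 h2
      exact ⟨h1.1.trans h2.1.symm, h1.2.trans h2.2.symm⟩
    | cons x v =>
      simp at h1 h2
      refine absurd hy' (h2.1 ▸ hT x ?_)
      rw [h1.2]; simp

theorem wordT_wordT {τ : A → A} (hτ : ∀ x, τ (τ x) = x) (w : List A) :
    wordT τ (wordT τ w) = w := by
  have : τ ∘ τ = id := funext hτ
  simp [wordT, List.map_reverse, this]

theorem wordT_rot {τ : A → A} {a b : List A} (h : List.IsRotated a b) :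
    List.IsRotated (wordT τ a) (wordT τ b) := (h.reverse).map τ

theorem wordT_wpow {τ : A → A} (a : List A) (m : ℕ) :
    wordT τ (wpow a m) = wpow (wordT τ a) m := by
  rw [wordT, wpow_reverse, wpow_map]; rfl

theorem simRel_refl {τ : A → A} (a : List A) : simRel τ a a := Or.inl (List.IsRotated.refl _)

theorem simRel_symm {τ : A → A} (hτ : ∀ x, τ (τ x) = x) {a b : List A} (h : simRel τ a b) :
    simRel τ b a := by
  rcases h with h | h
  · exact Or.inl h.symm
  · right
    have := wordT_rot (τ := τ) h
    rw [wordT_wordT hτ] at this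
    exact this.symm

theorem simRel_trans {τ : A → A} (hτ : ∀ x, τ (τ x) = x) {a b c : List A} (h : simRel τ a b)
    (h' : simRel τ b c) : simRel τ a c := by
  rcases h with h | h <;> rcases h' with h' | h'
  · exact Or.inl (h.trans h')
  · exact Or.inr (h.trans h')
  · exact Or.inr (h.trans (wordT_rot h'))
  · left
    have := wordT_rot (τ := τ) h'
    rw [wordT_wordT hτ] at this
    exact h.trans this

theorem prim_wordT {τ : A → A} (hτ : ∀ x, τ (τ x) = x) {a : List A} (ha : WPrimitive a) :
    WPrimitive (wordT τ a) := by
  refine ⟨fun h => ha.1 ?_, fun e m hm h => ha.2 (wordT τ e) m hm ?_⟩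
  · simpa [wordT] using h
  · rw [← wordT_wpow, ← h, wordT_wordT hτ]

theorem sim_pow {τ : A → A} (hτ : ∀ x, τ (τ x) = x) {a b : List A} {n m : ℕ}
    (ha : WPrimitive a) (hb : WPrimitive b)
    (h : simRel τ (wpow a (n+1)) (wpow b (m+1))) : simRel τ a b ∧ n = m := by
  rcases h with h | h
  · exact ⟨Or.inl (rot_pow ha hb h).1, (rot_pow ha hb h).2⟩
  · rw [wordT_wpow] at h
    exact ⟨Or.inr (rot_pow ha (prim_wordT hτ hb) h).1, (rot_pow ha (prim_wordT hτ hb) h).2⟩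

theorem prim_of_count_one {P : A → Bool} {w : List A} (h : w.countP P = 1) : WPrimitive w := by
  refine ⟨by rintro rfl; simp at h, ?_⟩
  rintro e m hm rfl
  rw [wpow_countP] at h
  have := Nat.eq_one_of_mul_eq_one_right h
  omega

end Words

section Classes
variable {d : ℕ}

theorem hTau_hTau (l : HLetter d) : hTau (hTau l) = l := by
  simp [hTau]

def levN (s : ℕ) (w : List (HLetter d)) : ℕ := w.countP (fun l => decide (letterLevel l = s))

theorem levN_append (s : ℕ) (u v : List (HLetter d)) : levN s (u ++ v) = levN s u + levN s v := by
  simp [levN]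

theorem levN_cons (s : ℕ) (l : HLetter d) (v : List (HLetter d)) :
    levN s (l :: v) = levN s v + if letterLevel l = s then 1 else 0 := by
  simp [levN, List.countP_cons]

theorem levN_wpow (s : ℕ) (u : List (HLetter d)) (m : ℕ) : levN s (wpow u m) = m * levN s u :=
  wpow_countP _ _ _

theorem levN_sim (s : ℕ) {a b : List (HLetter d)} (h : simRel hTau a b) : levN s a = levN s b := by
  rcases h with h | h
  · exact h.perm.countP_eq _
  · refine (h.perm.countP_eq _).trans ?_
    rw [wordT, List.countP_map, levN]
    exact (List.reverse_perm b).countP_eq _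

def clev (s : ℕ) : WClsH d → ℕ := Quot.lift (fun w => levN s w.1) (fun _ _ h => levN_sim s h)

theorem clev_out (s : ℕ) (c : WClsH d) : levN s (Quot.out c).1 = clev s c := by
  conv_rhs => rw [← Quot.out_eq c]
  rfl

theorem cls_eq {a b : PrimWordH d}
    (h : Quot.mk (fun a b : PrimWordH d => simRel hTau a.1 b.1) a = Quot.mk _ b) :
    simRel hTau a.1 b.1 := by
  have e : Equivalence (fun a b : PrimWordH d => simRel hTau a.1 b.1) :=
    ⟨fun a => simRel_refl _, fun h => simRel_symm hTau_hTau h, fun h h' => simRel_trans hTau_hTau h h'⟩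
  exact e.eqvGen_iff.1 (Quot.eqvGen_exact h)

theorem derivWord_split {q : ℕ+} {a : List (HLetter d)} {j : ℕ} {w : List (HLetter d)}
    (h : (match a[j]? with
    | some (Sum.inl k, b) => some (a.set j (Sum.inr (k, q), b))
    | _ => none) = some w) :
    ∃ u k b v, u.length = j ∧ a = u ++ (Sum.inl k, b) :: v ∧ w = u ++ (Sum.inr (k, q), b) :: v := by
  split at h
  · next k b hj =>
    obtain ⟨hlt, he⟩ := List.getElem?_eq_some_iff.1 hj
    refine ⟨a.take j, k, b, a.drop (j+1), ?_, ?_, ?_⟩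
    · simp; omega
    · rw [← he]; simp
    · rw [← Option.some.inj h, List.set_eq_take_append_cons_drop, if_pos hlt]
  · cases h

theorem mem_derivWords {q : ℕ+} {a w : List (HLetter d)} :
    w ∈ derivWords q a ↔
    ∃ u k b v, a = u ++ (Sum.inl k, b) :: v ∧ w = u ++ (Sum.inr (k, q), b) :: v := by
  constructor
  · intro h
    obtain ⟨j, -, hj⟩ := List.mem_filterMap.1 h
    obtain ⟨u, k, b, v, -, h1, h2⟩ := derivWord_split hj
    exact ⟨u, k, b, v, h1, h2⟩
  · rintro ⟨u, k, b, v, rfl, rfl⟩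
    refine List.mem_filterMap.2 ⟨u.length, by simp, ?_⟩
    simp

theorem levN_deriv {q : ℕ+} {a w : List (HLetter d)} (h : w ∈ derivWords q a) (s : ℕ) :
    (levN s w : ℤ) = levN s a + (if (q : ℕ) = s then 1 else 0) - (if 0 = s then 1 else 0) := by
  obtain ⟨u, k, b, v, rfl, rfl⟩ := mem_derivWords.1 h
  have e1 : letterLevel ((Sum.inl k, b) : HLetter d) = 0 := rfl
  have e2 : letterLevel ((Sum.inr (k, q), b) : HLetter d) = q := rfl
  rw [levN_append, levN_append, levN_cons, levN_cons, e1, e2]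
  push_cast
  ring

def wt (s : ℕ) (v : ℕ+ × WClsH d) : ℤ := (v.1 : ℕ) * clev s v.2

variable (F : Type*) [Field F]

theorem trW_hom (s : ℕ) (w : List (HLetter d)) :
    MvPolynomial.IsWeightedHomogeneous (wt s) (trW F w) (levN s w : ℤ) := by
  unfold trW
  split
  · next h =>
    have := MvPolynomial.isWeightedHomogeneous_X F (wt s) (1, Quot.mk _ (⟨w, h⟩ : PrimWordH d))
    simpa [wt, clev] using this
  · exact MvPolynomial.isWeightedHomogeneous_zero _ _ _

theorem sigVar_hom (s : ℕ) (t : ℕ) (c : WClsH d) :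
    MvPolynomial.IsWeightedHomogeneous (wt s) (sigVar F t c) (t * clev s c : ℤ) := by
  unfold sigVar
  split
  · next h =>
    have := MvPolynomial.isWeightedHomogeneous_X F (wt s) ((⟨t, h⟩ : ℕ+), c)
    simpa [wt] using this
  · have : t = 0 := by omega
    subst this
    simpa using MvPolynomial.isWeightedHomogeneous_one F (wt s)

theorem list_sum_hom {σ ι M : Type*} [AddCommMonoid M] (w : σ → M) (n : M) (L : List ι)
    (g : ι → MvPolynomial σ F)
    (h : ∀ x ∈ L, MvPolynomial.IsWeightedHomogeneous w (g x) n) :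
    MvPolynomial.IsWeightedHomogeneous w (L.map g).sum n := by
  induction L with
  | nil => exact MvPolynomial.isWeightedHomogeneous_zero _ _ _
  | cons x L ih =>
    simp only [List.map_cons, List.sum_cons]
    exact (h x (by simp)).add (ih fun y hy => h y (by simp [hy]))

theorem dVal_hom (s : ℕ) (q : ℕ+) (v : ℕ+ × WClsH d) :
    MvPolynomial.IsWeightedHomogeneous (wt s) (dVal F q v)
      (wt s v + (if (q : ℕ) = s then 1 else 0) - (if 0 = s then 1 else 0)) := by
  unfold dVal
  refine MvPolynomial.IsWeightedHomogeneous.sum _ _ _ fun i hi => ?_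
  have hi := Finset.mem_range.1 hi
  set b := (Quot.out v.2).1 with hb
  have h1 : MvPolynomial.IsWeightedHomogeneous (wt s) ((-1 : NsigmaH F d) ^ i) 0 := by
    have := MvPolynomial.isWeightedHomogeneous_C (R := F) (wt (d := d) s) ((-1) ^ i)
    simpa using this
  have h2 := list_sum_hom F (wt s) (((i : ℤ) + 1) * clev s v.2 + (if (q : ℕ) = s then 1 else 0)
      - (if 0 = s then 1 else 0)) (derivWords q b) (fun w => trW F (wpow b i ++ w)) (by
      intro w hw
      have := trW_hom F s (wpow b i ++ w)
      convert this using 1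
      rw [levN_append, levN_wpow]
      push_cast
      rw [levN_deriv hw s, hb, clev_out]
      ring)
  have h3 := (h1.mul h2).mul (sigVar_hom F s ((v.1 : ℕ) - i - 1) v.2)
  have hw : wt s v = (v.1 : ℕ) * clev s v.2 := rfl
  have this : (((v.1 : ℕ) - i - 1 : ℕ) : ℤ) = (v.1 : ℕ) - i - 1 := by omega
  have e : wt s v + (if (q : ℕ) = s then 1 else 0) - (if 0 = s then 1 else 0) =
    (0 + (((i : ℤ) + 1) * clev s v.2 + (if (q : ℕ) = s then 1 else 0)
      - (if 0 = s then 1 else 0)) + (((v.1 : ℕ) - i - 1 : ℕ) : ℤ) * clev s v.2) := by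
    rw [hw, this]
    ring
  rw [e]
  exact h3

theorem DS_support (s : ℕ) (q : ℕ+) (g : NsigmaH F d) (u' : (ℕ+ × WClsH d) →₀ ℕ)
    (hu : u' ∈ (DS F d q g).support) : ∃ u ∈ g.support,
    Finsupp.weight (wt s) u' = Finsupp.weight (wt s) u +
      (if (q : ℕ) = s then 1 else 0) - (if 0 = s then 1 else 0) := by
  classical
  by_contra hcon
  push Not at hcon
  rw [MvPolynomial.mem_support_iff] at hu
  apply hu
  rw [MvPolynomial.as_sum g, map_sum, MvPolynomial.coeff_sum]
  refine Finset.sum_eq_zero fun u huu => ?_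
  rw [DS, MvPolynomial.mkDerivation_monomial, MvPolynomial.coeff_smul, Finsupp.sum,
    MvPolynomial.coeff_sum, Finset.sum_eq_zero, smul_zero]
  intro v hv
  have hmon : MvPolynomial.IsWeightedHomogeneous (wt s)
    (MvPolynomial.monomial (u - Finsupp.single v 1) ((u v : ℕ) : F)) 
      (Finsupp.weight (wt s) u - wt s v) := by
    apply MvPolynomial.isWeightedHomogeneous_monomial
    have hle : Finsupp.single v 1 ≤ u := by
      rw [Finsupp.single_le_iff]
      exact Nat.one_le_iff_ne_zero.2 (Finsupp.mem_support_iff.1 hv)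
    have := congrArg (Finsupp.weight (wt s)) (tsub_add_cancel_of_le hle)
    rw [map_add, Finsupp.weight_single] at this
    rw [← this]; simp
  have := hmon.mul (dVal_hom F s q v)
  rw [smul_eq_mul]
  refine this.coeff_eq_zero _ ?_
  intro h
  apply hcon u huu
  rw [h]; ring

theorem DSIter_support (s : ℕ) (f : NsigmaH F d) (q : ℕ) (u' : (ℕ+ × WClsH d) →₀ ℕ)
    (hu : u' ∈ (DSIter F d q f).support) : ∃ u ∈ f.support,
    Finsupp.weight (wt s) u' = Finsupp.weight (wt s) u +
      (if 1 ≤ s ∧ s ≤ q then 1 else 0) - (if 0 = s then q else 0) := by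
  induction q generalizing u' with
  | zero => exact ⟨u', hu, by
      have : ¬ (1 ≤ s ∧ s ≤ 0) := by omega
      rw [if_neg this]; simp⟩
  | succ q ih =>
    obtain ⟨u, h1, h2⟩ := DS_support F s _ _ _ hu
    obtain ⟨u0, h3, h4⟩ := ih u h1
    refine ⟨u0, h3, ?_⟩
    rw [h2, h4]
    simp only [Nat.succPNat_coe, Nat.succ_eq_add_one]
    split_ifs <;> omega

end Classes

section Indep
variable {d : ℕ}

def unmark (r : ℕ+) (l : HLetter d) : HLetter d :=
  match l with
  | (Sum.inl k, b) => (Sum.inl k, b)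
  | (Sum.inr (k, s), b) => if s = r then (Sum.inl k, b) else (Sum.inr (k, s), b)

theorem unmark_tau (r : ℕ+) (l : HLetter d) : unmark r (hTau l) = hTau (unmark r l) := by
  rcases l with ⟨k | ⟨k, s⟩, b⟩
  · rfl
  · simp only [hTau, unmark]; split_ifs <;> rfl

theorem unmark_sim (r : ℕ+) {a b : List (HLetter d)} (h : simRel hTau a b) :
    simRel hTau (a.map (unmark r)) (b.map (unmark r)) := by
  rcases h with h | h
  · exact Or.inl (h.map _)
  · right
    have := h.map (unmark r)
    have e : (unmark r) ∘ hTau = (hTau (d := d)) ∘ (unmark r) := funext (unmark_tau r)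
    simpa [wordT, e] using this

theorem levN_zero_iff {s : ℕ} {a : List (HLetter d)} :
    levN s a = 0 ↔ ∀ l ∈ a, letterLevel l ≠ s := by
  simp [levN, List.countP_eq_zero]

theorem unmark_of_free {r : ℕ+} {a : List (HLetter d)} (h : levN r a = 0) :
    a.map (unmark r) = a := by
  rw [levN_zero_iff] at h
  conv_rhs => rw [← List.map_id a]
  refine List.map_congr_left fun l hl => ?_
  have := h l hl
  rcases l with ⟨k | ⟨k, s⟩, b⟩
  · rfl
  · simp only [letterLevel] at this
    simp only [unmark, id]
    rw [if_neg]
    rintro rfl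
    exact this rfl

theorem unmark_deriv {r : ℕ+} {a w : List (HLetter d)} (h : levN r a = 0)
    (hw : w ∈ derivWords r a) : w.map (unmark r) = a := by
  have h0 := unmark_of_free h
  obtain ⟨u, k, b, v, rfl, rfl⟩ := mem_derivWords.1 hw
  rw [← h0]
  simp [unmark]

theorem levN_pow_deriv {r : ℕ+} {a w : List (HLetter d)} (h : levN r a = 0)
    (hw : w ∈ derivWords r a) (i : ℕ) : levN r (wpow a i ++ w) = 1 := by
  have := levN_deriv hw r
  have h2 := r.pos
  rw [levN_append, levN_wpow, h]
  rw [h, if_pos rfl, if_neg (by omega)] at this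
  omega

theorem prim_pow_deriv {r : ℕ+} {a w : List (HLetter d)} (h : levN r a = 0)
    (hw : w ∈ derivWords r a) (i : ℕ) : WPrimitive (wpow a i ++ w) :=
  prim_of_count_one (levN_pow_deriv h hw i)

theorem deriv_inj {r : ℕ+} {a : List (HLetter d)} (ha : WPrimitive a) (h : levN r a = 0) (i : ℕ)
    {u u' v v' : List (HLetter d)} {k k' : Fin d} {b b' : Bool}
    (h1 : a = u ++ (Sum.inl k, b) :: v) (h2 : a = u' ++ (Sum.inl k', b') :: v')
    (hr : List.IsRotated (wpow a i ++ (u ++ (Sum.inr (k, r), b) :: v))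
      (wpow a i ++ (u' ++ (Sum.inr (k', r), b') :: v'))) : u = u' := by
  have e1 : List.IsRotated ((Sum.inr (k, r), b) :: (v ++ (wpow a i ++ u)))
      (wpow a i ++ (u ++ (Sum.inr (k, r), b) :: v)) :=
    rot_iff.2 ⟨(Sum.inr (k, r), b) :: v, wpow a i ++ u, by simp, by simp⟩
  have e2 : List.IsRotated (wpow a i ++ (u' ++ (Sum.inr (k', r), b') :: v'))
      ((Sum.inr (k', r), b') :: (v' ++ (wpow a i ++ u'))) :=
    rot_iff.2 ⟨wpow a i ++ u', (Sum.inr (k', r), b') :: v', by simp, by simp⟩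
  have hz : levN (d := d) r (v ++ (wpow a i ++ u)) = 0 := by
    have : levN (d := d) r (u ++ (Sum.inl k, b) :: v) = 0 := h1 ▸ h
    simp only [levN_append, levN_cons] at this
    rw [levN_append, levN_append, levN_wpow, h]
    omega
  obtain ⟨hy, hT⟩ := rot_unique (P := fun l : HLetter d => letterLevel l = r) rfl
    (levN_zero_iff.1 hz) ((e1.trans hr).trans e2)
  obtain ⟨⟨rfl, -⟩, rfl⟩ : (k = k' ∧ True) ∧ b = b' := by simpa using hy
  have key : ∀ u v : List (HLetter d), a = u ++ (Sum.inl k, b) :: v →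
      (Sum.inl k, b) :: (v ++ (wpow a i ++ u)) = wpow (((Sum.inl k, b) :: v) ++ u) (i+1) := by
    intro u v hv
    rw [hv, wpow_conj, wpow_succ]; simp
  have k1 := key u v h1
  have k2 := key u' v' h2
  rw [hT, k2] at k1
  have p1 : WPrimitive (((Sum.inl k, b) :: v) ++ u) :=
    prim_rot (rot_iff.2 ⟨u, _, h1, rfl⟩) ha
  have p2 : WPrimitive (((Sum.inl k, b) :: v') ++ u') :=
    prim_rot (rot_iff.2 ⟨u', _, h2, rfl⟩) ha
  have := (prim_pow_eq p2 p1 k1).1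
  exact prim_split (h1 ▸ ha) (h1.symm.trans h2) (by simp) (by simp) this.symm

theorem deriv_pairwise {r : ℕ+} {a : List (HLetter d)} (ha : WPrimitive a) (h : levN r a = 0)
    (i : ℕ) : (derivWords r a).Pairwise
      (fun w w' => ¬ List.IsRotated (wpow a i ++ w) (wpow a i ++ w')) := by
  unfold derivWords
  rw [List.pairwise_filterMap]
  refine List.pairwise_lt_range.imp ?_
  intro j j' hj w hw w' hw' hr
  obtain ⟨u, k, b, v, hl, h1, rfl⟩ := derivWord_split hw
  obtain ⟨u', k', b', v', hl', h1', rfl⟩ := derivWord_split hw'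
  have := deriv_inj ha h i h1 h1' hr
  subst this
  omega

variable (F : Type*) [Field F]

def clsOf (w : List (HLetter d)) (hw : WPrimitive w) : WClsH d := Quot.mk _ (⟨w, hw⟩ : PrimWordH d)

theorem clsOf_eq_iff {w w' : List (HLetter d)} (hw : WPrimitive w) (hw' : WPrimitive w') :
    clsOf w hw = clsOf w' hw' ↔ simRel hTau w w' :=
  ⟨fun h => cls_eq h, fun h => Quot.sound h⟩

theorem trW_prim {w : List (HLetter d)} (hw : WPrimitive w) :
    trW F w = MvPolynomial.X (1, clsOf w hw) := by
  unfold trW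
  rw [dif_pos hw]
  rfl

theorem pderiv_trW {w w' : List (HLetter d)} (hw : WPrimitive w) (hw' : WPrimitive w')
    [Decidable (simRel hTau w w')] :
    MvPolynomial.pderiv (1, clsOf w' hw') (trW F w) =
      if simRel hTau w w' then 1 else 0 := by
  rw [trW_prim F hw]
  split_ifs with h
  · rw [(clsOf_eq_iff hw hw').2 h, MvPolynomial.pderiv_X_self]
  · apply MvPolynomial.pderiv_X_of_ne
    intro h'
    exact h ((clsOf_eq_iff hw hw').1 (Prod.ext_iff.1 h').2)

theorem deriv_sum_apply {R A M ι : Type*} [CommSemiring R] [CommSemiring A] [AddCommMonoid M]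
    [Algebra R A] [Module A M] [Module R M] (s : Finset ι) (D : ι → Derivation R A M) (x : A) :
    (∑ i ∈ s, D i) x = ∑ i ∈ s, D i x := by
  classical
  induction s using Finset.induction_on with
  | empty => simp
  | insert i s hi ih => rw [Finset.sum_insert hi, Finset.sum_insert hi, Derivation.add_apply, ih]

theorem sum_ite_len {ι R : Type*} [CommRing R] (L : List ι) (g : ι → R) (P : ι → Prop)
    [DecidablePred P] (h : ∀ x ∈ L, g x = if P x then 1 else 0) :
    (L.map g).sum = ((L.filter (fun x => decide (P x))).length : R) := by
  induction L with
  | nil => simp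
  | cons x L ih =>
    rw [List.map_cons, List.sum_cons, ih fun y hy => h y (by simp [hy]), h x (by simp),
      List.filter_cons]
    by_cases hx : P x <;> simp [hx, add_comm]

theorem pderiv_sum_main {r : ℕ+} {a : List (HLetter d)} (ha : WPrimitive a) (h : levN r a = 0)
    (i : ℕ) {w₀ : List (HLetter d)} (hw₀ : w₀ ∈ derivWords r a) :
    ∃ m : ℕ, (m = 1 ∨ m = 2) ∧
    MvPolynomial.pderiv (1, clsOf (wpow a i ++ w₀) (prim_pow_deriv h hw₀ i))
      ((derivWords r a).map (fun w => trW F (wpow a i ++ w))).sum = (m : NsigmaH F d) := by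
  classical
  rw [map_list_sum, List.map_map]
  rw [sum_ite_len _ _ (fun w => simRel hTau (wpow a i ++ w) (wpow a i ++ w₀))]
  · refine ⟨_, ?_, rfl⟩
    set L := (derivWords r a).filter
      (fun w => decide (simRel hTau (wpow a i ++ w) (wpow a i ++ w₀))) with hL
    have hp : L.Pairwise (fun w w' => ¬ List.IsRotated (wpow a i ++ w) (wpow a i ++ w')) :=
      (deriv_pairwise ha h i).filter _
    have hs : ∀ w ∈ L, simRel hTau (wpow a i ++ w) (wpow a i ++ w₀) := by
      intro w hw
      simpa using (List.mem_filter.1 hw).2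
    have h0 : w₀ ∈ L := List.mem_filter.2 ⟨hw₀, by simpa using simRel_refl _⟩
    clear_value L
    match L, hp, hs, h0 with
    | [], _, _, h0 => simp at h0
    | [_], _, _, _ => simp
    | [_, _], _, _, _ => simp
    | w1 :: w2 :: w3 :: L, hp, hs, _ =>
      exfalso
      simp only [List.pairwise_cons] at hp
      have n12 := hp.1 w2 (by simp)
      have n13 := hp.1 w3 (by simp)
      have n23 := hp.2.1 w3 (by simp)
      rcases hs w1 (by simp) with s1 | s1 <;> rcases hs w2 (by simp) with s2 | s2 <;>
      rcases hs w3 (by simp) with s3 | s3 <;>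
      first
        | exact n12 (s1.trans s2.symm)
        | exact n13 (s1.trans s3.symm)
        | exact n23 (s2.trans s3.symm)
  · intro w hw
    rw [Function.comp_apply, pderiv_trW F (prim_pow_deriv h hw i)]

theorem pderiv_sum_zero {r : ℕ+} {a b : List (HLetter d)} (ha : WPrimitive a) (h : levN r a = 0)
    (hb : WPrimitive b) (hb0 : levN r b = 0)
    (n i : ℕ) {w₀ : List (HLetter d)} (hw₀ : w₀ ∈ derivWords r a)
    (hne : ¬ (simRel hTau b a ∧ i = n)) :
    MvPolynomial.pderiv (1, clsOf (wpow a n ++ w₀) (prim_pow_deriv h hw₀ n))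
      ((derivWords r b).map (fun w => trW F (wpow b i ++ w))).sum = 0 := by
  classical
  rw [map_list_sum, List.map_map]
  apply List.sum_eq_zero
  intro x hx
  obtain ⟨w, hw, rfl⟩ := List.mem_map.1 hx
  rw [Function.comp_apply, pderiv_trW F (prim_pow_deriv hb0 hw i), if_neg]
  intro he
  apply hne
  have h1 := unmark_sim r he
  simp only [List.map_append] at h1
  rw [unmark_deriv hb0 hw, unmark_deriv h hw₀, wpow_map, wpow_map, unmark_of_free h,
    unmark_of_free hb0, ← wpow_succ', ← wpow_succ'] at h1
  exact sim_pow hTau_hTau hb ha h1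

theorem pderiv_dVal {r : ℕ+} (v : ℕ+ × WClsH d) (hv : clev r v.2 = 0) (c : WClsH d)
    (hc : clev r c ≠ 0) :
    MvPolynomial.pderiv (1, c) (dVal F r v) = ∑ i ∈ Finset.range (v.1 : ℕ),
    (-1 : NsigmaH F d) ^ i *
      MvPolynomial.pderiv (1, c) ((derivWords r (Quot.out v.2).1).map
          (fun w => trW F (wpow (Quot.out v.2).1 i ++ w))).sum *
        sigVar F ((v.1 : ℕ) - i - 1) v.2 := by
  unfold dVal
  rw [map_sum]
  refine Finset.sum_congr rfl fun i _ => ?_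
  have h1 : MvPolynomial.pderiv (1, c) ((-1 : NsigmaH F d) ^ i) = 0 := by
    have : ((-1 : NsigmaH F d) ^ i) = MvPolynomial.C ((-1) ^ i) := by simp
    rw [this, MvPolynomial.pderiv_C]
  have h2 : MvPolynomial.pderiv (1, c) (sigVar F ((v.1 : ℕ) - i - 1) v.2) = 0 := by
    unfold sigVar
    split
    · apply MvPolynomial.pderiv_X_of_ne
      intro h
      have := (Prod.ext_iff.1 h).2
      simp only at this
      exact hc (this ▸ hv)
    · exact MvPolynomial.pderiv_one
  rw [MvPolynomial.pderiv_mul, MvPolynomial.pderiv_mul, h1, h2]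
  ring

theorem DS_eq_sum (r : ℕ+) (g : NsigmaH F d) :
    DS F d r g = ∑ v ∈ g.vars, MvPolynomial.pderiv v g * dVal F r v := by
  classical
  have : DS F d r g = (∑ v ∈ g.vars, dVal F r v • MvPolynomial.pderiv (R := F) v :
      Derivation F (NsigmaH F d) (NsigmaH F d)) g := by
    apply MvPolynomial.derivation_eq_of_forall_mem_vars
    intro i hi
    rw [DS, MvPolynomial.mkDerivation_X, deriv_sum_apply,
      Finset.sum_eq_single i]
    · simp
    · intro b _ hb
      simp [MvPolynomial.pderiv_X_of_ne hb.symm]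
    · exact fun h => absurd hi h
  rw [this, deriv_sum_apply]
  refine Finset.sum_congr rfl fun v _ => ?_
  simp [mul_comm]

theorem pderiv_pderiv_zero {σ : Type*} (i j : σ) (g : MvPolynomial σ F) (h : i ∉ g.vars) :
    MvPolynomial.pderiv i (MvPolynomial.pderiv j g) = 0 := by
  classical
  have h0 : MvPolynomial.pderiv i g = 0 := MvPolynomial.pderiv_eq_zero_of_notMem_vars h
  rcases eq_or_ne i j with rfl | hij
  · rw [h0, map_zero]
  ext m
  have := congrArg (MvPolynomial.coeff (m + Finsupp.single j 1)) h0
  rw [MvPolynomial.coeff_pderiv] at this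
  rw [MvPolynomial.coeff_pderiv, MvPolynomial.coeff_pderiv]
  simp only [Finsupp.add_apply, Finsupp.single_apply, MvPolynomial.coeff_zero, hij, hij.symm,
    if_false, add_zero] at this ⊢
  rw [add_right_comm] at this
  linear_combination ((m j : F) + 1) * this

theorem pderiv_zero_of_DS_zero (hchar : ringChar F ≠ 2) (r : ℕ+) (g : NsigmaH F d)
    (hg : ∀ v ∈ g.vars, clev r v.2 = 0) (hD : DS F d r g = 0) (α : WClsH d)
    (hα : clev r α = 0) (hx : clev 0 α ≠ 0) (t : ℕ+) :
    MvPolynomial.pderiv (t, α) g = 0 := by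
  classical
  set a := (Quot.out α).1 with haa
  have ha : WPrimitive a := (Quot.out α).2
  have hr : levN r a = 0 := by rw [haa, clev_out, hα]
  obtain ⟨w₀, hw₀⟩ : ∃ w₀, w₀ ∈ derivWords r a := by
    rw [← clev_out, ← haa] at hx
    rw [Ne, levN_zero_iff] at hx
    push Not at hx
    obtain ⟨⟨k | ⟨k, s⟩, b⟩, hl, h0⟩ := hx
    · obtain ⟨u, v, huv⟩ := List.append_of_mem hl
      exact ⟨_, mem_derivWords.2 ⟨u, k, b, v, huv, rfl⟩⟩
    · exact absurd h0 s.pos.ne'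
  obtain ⟨N, hN⟩ : ∃ N : ℕ, ∀ v ∈ g.vars, (v.1 : ℕ) ≤ N :=
    ⟨g.vars.sup fun v => (v.1 : ℕ), fun v hv => Finset.le_sup (f := fun v => (v.1 : ℕ)) hv⟩
  have main : ∀ k (t : ℕ+), N + 1 ≤ t + k → MvPolynomial.pderiv (t, α) g = 0 := by
    intro k
    induction k with
    | zero =>
      intro t ht
      apply MvPolynomial.pderiv_eq_zero_of_notMem_vars
      intro h
      have := hN _ h
      simp only at this
      omega
    | succ k ih =>
      intro t ht
      by_cases htv : (t, α) ∈ g.vars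
      swap
      · exact MvPolynomial.pderiv_eq_zero_of_notMem_vars htv
      obtain ⟨n, hn⟩ : ∃ n, (t : ℕ) = n + 1 := ⟨t - 1, by have := t.pos; omega⟩
      set c : WClsH d := clsOf (wpow a n ++ w₀) (prim_pow_deriv hr hw₀ n) with hc
      have hcl : clev r c ≠ 0 := by
        have : clev r c = 1 := levN_pow_deriv hr hw₀ n
        omega
      have hcv : ((1 : ℕ+), c) ∉ g.vars := fun h => hcl (hg _ h)
      have h1 := congrArg (MvPolynomial.pderiv ((1 : ℕ+), c)) hD
      rw [DS_eq_sum, map_zero, map_sum, Finset.sum_eq_single (t, α)] at h1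
      · rw [MvPolynomial.pderiv_mul, pderiv_pderiv_zero F _ _ _ hcv, zero_mul, zero_add,
          pderiv_dVal F _ hα _ hcl] at h1
        simp only at h1
        rw [hn, Finset.sum_range_succ, Finset.sum_eq_zero, zero_add] at h1
        · obtain ⟨m, hm, hme⟩ := pderiv_sum_main F ha hr n hw₀
          rw [← haa, hme] at h1
          have hs : sigVar F (n + 1 - n - 1) α = 1 := by simp [sigVar]
          rw [hs, mul_one] at h1
          refine (mul_eq_zero.1 h1).resolve_right (mul_ne_zero (pow_ne_zero _ (by simp)) ?_)
          have : (m : NsigmaH F d) = MvPolynomial.C (m : F) := by simp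
          rw [this, Ne, MvPolynomial.C_eq_zero]
          rcases hm with rfl | rfl
          · simp
          · simpa using Ring.two_ne_zero hchar
        · intro i hi
          have hi := Finset.mem_range.1 hi
          rw [← haa, pderiv_sum_zero F ha hr ha hr n i hw₀ (by omega)]
          simp
      · rintro ⟨t', β⟩ hv hne
        by_cases hβ : β = α
        · subst hβ
          have hne' : (t' : ℕ) ≠ t := fun h => hne (by rw [PNat.coe_inj.1 h])
          rcases lt_or_gt_of_ne hne' with hlt | hgt
          · rw [MvPolynomial.pderiv_mul, pderiv_pderiv_zero F _ _ _ hcv, zero_mul, zero_add,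
              pderiv_dVal F _ hα _ hcl, Finset.sum_eq_zero, mul_zero]
            intro i hi
            have hi := Finset.mem_range.1 hi
            simp only at hi
            rw [← haa, pderiv_sum_zero F ha hr ha hr n i hw₀ (by omega)]
            simp
          · rw [ih t' (by omega), zero_mul, map_zero]
        · rw [MvPolynomial.pderiv_mul, pderiv_pderiv_zero F _ _ _ hcv, zero_mul, zero_add,
              pderiv_dVal F _ (hg _ hv) _ hcl, Finset.sum_eq_zero, mul_zero]
          intro i hi
          rw [pderiv_sum_zero F ha hr (Quot.out β).2 (by rw [clev_out]; exact hg _ hv) n i hw₀ ?_]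
          · simp
          · rintro ⟨h, -⟩
            apply hβ
            rw [← Quot.out_eq β, ← Quot.out_eq α]
            exact Quot.sound h
      · exact fun h => absurd htv h
  exact main (N + 1) t (by omega)

end Indep

section Final
variable {d : ℕ}

theorem hdeg_le (z : HBase d) (b : Bool) (w : List (HLetter d)) :
    hdeg z w ≤ levN (letterLevel (z, b)) w := by
  rw [hdeg, ← List.countP_eq_length_filter, levN]
  apply List.countP_mono_left
  rintro ⟨z', b'⟩ _ h
  have : z' = z := by simpa using h
  subst this
  simp [letterLevel]

theorem weight_eq (s : ℕ) (u : (ℕ+ × WClsH d) →₀ ℕ) :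
    Finsupp.weight (wt s) u =
      ((∑ v ∈ u.support, u v * (v.1 : ℕ) * levN s (Quot.out v.2).1 : ℕ) : ℤ) := by
  rw [Finsupp.weight_apply, Finsupp.sum]
  push_cast
  refine Finset.sum_congr rfl fun v _ => ?_
  rw [clev_out, wt, nsmul_eq_mul, mul_assoc]

theorem weight_nonneg (s : ℕ) (u : (ℕ+ × WClsH d) →₀ ℕ) : 0 ≤ Finsupp.weight (wt s) u := by
  rw [weight_eq]; positivity

theorem weight_level_zero (s : ℕ) (hs : 1 ≤ s) (u : (ℕ+ × WClsH d) →₀ ℕ)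
    (h : ∀ v ∈ u.support, ∀ l ∈ (Quot.out v.2).1, letterLevel l = 0) :
    Finsupp.weight (wt s) u = 0 := by
  rw [weight_eq, Finset.sum_eq_zero]
  · rfl
  · intro v hv
    rw [levN_zero_iff.2, mul_zero]
    intro l hl
    rw [h v hv l hl]
    omega

end Final


/-- **Lemma 4.3.** Assume `char F = p ≠ 2` and let `f ∈ N_σ` be nonzero (every word
occurring in `f` consists of letters of level `0`, i.e. of the letters `x_k`, `x_k^T`).
Then there is a `q ≥ 0` such that `∂_q ⋯ ∂_1(f)` is a nonzero `p`-multilinear element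
of `N̂_σ`. -/
theorem exists_pMultilinear_derivative (F : Type*) [Field F] (hchar : ringChar F ≠ 2)
    (d : ℕ) (hd : 1 ≤ d) (f : NsigmaH F d) (hf0 : f ≠ 0)
    (hlev : ∀ u ∈ f.support, ∀ v ∈ u.support, ∀ l ∈ (Quot.out v.2).1,
      letterLevel l = 0) :
    ∃ q : ℕ, DSIter F d q f ≠ 0 ∧ PMulti F (DSIter F d q f) := by
  classical
  obtain ⟨N, hN⟩ : ∃ N : ℕ, ∀ u ∈ f.support, Finsupp.weight (wt 0) u ≤ N :=
    ⟨f.support.sup fun u => (Finsupp.weight (wt 0) u).toNat, fun u hu => by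
      have := Finset.le_sup (f := fun u => (Finsupp.weight (wt (d := d) 0) u).toNat) hu
      omega⟩
  have hex : ∃ q, DSIter F d q f = 0 := by
    refine ⟨N + 1, ?_⟩
    by_contra hne
    obtain ⟨u', hu'⟩ := MvPolynomial.support_nonempty.2 hne
    obtain ⟨u, hu, he⟩ := DSIter_support F 0 f (N + 1) u' hu'
    have h1 := weight_nonneg 0 u'
    have h2 := hN u hu
    rw [he, if_neg (by omega), if_pos rfl] at h1
    push_cast at h1
    omega
  obtain ⟨Q, hQ⟩ : ∃ Q, Nat.find hex = Q + 1 := by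
    refine ⟨Nat.find hex - 1, ?_⟩
    have : Nat.find hex ≠ 0 := by
      intro h
      have := Nat.find_spec hex
      rw [h] at this
      exact hf0 this
    omega
  have hz : DSIter F d (Q + 1) f = 0 := hQ ▸ Nat.find_spec hex
  have hnz : DSIter F d Q f ≠ 0 := Nat.find_min hex (by omega)
  refine ⟨Q, hnz, ?_⟩
  set g := DSIter F d Q f with hg
  -- level weights of the monomials of g
  have hw : ∀ s, 1 ≤ s → ∀ u ∈ g.support,
      ∑ v ∈ u.support, u v * (v.1 : ℕ) * levN s (Quot.out v.2).1 = if s ≤ Q then 1 else 0 := by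
    intro s hs u' hu'
    obtain ⟨u, hu, he⟩ := DSIter_support F s f Q u' hu'
    rw [weight_level_zero s hs u (hlev u hu), weight_eq, if_neg (by omega : ¬ 0 = s)] at he
    have : (if 1 ≤ s ∧ s ≤ Q then (1 : ℤ) else 0) = ((if s ≤ Q then 1 else 0 : ℕ) : ℤ) := by
      split_ifs <;> first | rfl | omega
    rw [this] at he
    push_cast at he ⊢
    zify
    push_cast
    simpa using he
  have hp1 : ringChar F ≠ 1 := CharP.ringChar_ne_one
  refine ⟨Set.range Sum.inl, fun u hu => ⟨?_, ?_⟩⟩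
  · rintro (k | ⟨k, s⟩) hz'
    · exact absurd ⟨k, rfl⟩ hz'
    have hle : ∑ v ∈ u.support, u v * (v.1 : ℕ) * levN s (Quot.out v.2).1 ≤ 1 := by
      rw [hw s s.pos u hu]; split_ifs <;> omega
    have hd' : ∀ v : ℕ+ × WClsH d, hdeg (Sum.inr (k, s)) (Quot.out v.2).1 ≤
        levN s (Quot.out v.2).1 := fun v => hdeg_le (Sum.inr (k, s)) false _
    constructor
    · refine Finset.sum_eq_zero fun v hv => ?_
      by_cases h0 : hdeg (Sum.inr (k, s)) (Quot.out v.2).1 = 0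
      · rw [h0, mul_zero]
      · have h1 := (Finset.single_le_sum (f := fun v : ℕ+ × WClsH d =>
          u v * (v.1 : ℕ) * levN s (Quot.out v.2).1) (fun _ _ => Nat.zero_le _) hv).trans hle
        have h2 : 1 ≤ levN s (Quot.out v.2).1 := by have := hd' v; omega
        have h3 : u v ≤ 1 := by
          calc u v ≤ u v * (v.1 : ℕ) := Nat.le_mul_of_pos_right _ v.1.pos
            _ ≤ u v * (v.1 : ℕ) * levN s (Quot.out v.2).1 := Nat.le_mul_of_pos_right _ h2
            _ ≤ 1 := h1
        have h4 : u v % ringChar F = u v := by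
          rcases Nat.eq_zero_or_pos (ringChar F) with hp | hp
          · rw [hp, Nat.mod_zero]
          · exact Nat.mod_eq_of_lt (by omega)
        rw [h4]; simp
    · refine le_trans (Finset.sum_le_sum fun v hv => ?_) hle
      exact Nat.mul_le_mul (Nat.mul_le_mul_right _ (Nat.mod_le _ _)) (hd' v)
  · rintro _ ⟨k, rfl⟩
    refine Finset.sum_eq_zero fun v hv => ?_
    by_cases h0 : hdeg (Sum.inl k) (Quot.out v.2).1 = 0
    · rw [h0, mul_zero]
    · have hfree : ∀ u ∈ g.support, ∀ v ∈ u.support, clev (Q.succPNat : ℕ) v.2 = 0 := by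
        intro u hu v hv
        have h1 := hw (Q.succPNat : ℕ) Q.succPNat.pos u hu
        rw [if_neg (by simp), Finset.sum_eq_zero_iff] at h1
        have h2 := h1 v hv
        rw [clev_out] at h2
        exact (Nat.mul_eq_zero.1 h2).resolve_left
          (Nat.mul_ne_zero (Finsupp.mem_support_iff.1 hv) v.1.pos.ne')
      have hx : clev 0 v.2 ≠ 0 := by
        have : hdeg (Sum.inl k) (Quot.out v.2).1 ≤ levN 0 (Quot.out v.2).1 :=
          hdeg_le (Sum.inl k) false _
        rw [clev_out] at this
        omega
      have hpd := pderiv_zero_of_DS_zero F hchar Q.succPNat g (by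
        intro v hv
        obtain ⟨u, hu, hv⟩ := (MvPolynomial.mem_vars_iff_mem_support v).1 hv
        exact hfree u hu v hv) hz v.2 (hfree u hu v hv) hx v.1
      have hc := congrArg (MvPolynomial.coeff (u - Finsupp.single v 1)) hpd
      have huv : u v ≠ 0 := Finsupp.mem_support_iff.1 hv
      have hsle : Finsupp.single v 1 ≤ u := by
        rw [Finsupp.single_le_iff]; exact Nat.one_le_iff_ne_zero.2 huv
      rw [show ((v.1, v.2) : ℕ+ × WClsH d) = v from rfl, MvPolynomial.coeff_pderiv,
        MvPolynomial.coeff_zero, tsub_add_cancel_of_le hsle] at hc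
      have h3 := (mul_eq_zero.1 hc).resolve_left (MvPolynomial.mem_support_iff.1 hu)
      have h4 : ((u v : ℕ) : F) = 0 := by
        rw [← h3]
        simp only [Finsupp.coe_tsub, Pi.sub_apply, Finsupp.single_eq_same]
        rw [Nat.cast_sub (by omega)]
        simp
      have h5 := (ringChar.spec F (u v)).1 h4
      rw [Nat.mod_eq_zero_of_dvd h5, zero_mul, zero_mul]
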